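/- For n ≥ 2, the elements e_1 and e_1* = r_0e_1r_0 commute in Br(B_n): e_1·(r_0e_1r_0) = (r_0e_1r_0)·e_1. -/

import Mathlib

/-- The ground ring `ℤ[δ, δ⁻¹]` of Laurent polynomials over `ℤ`. -/
abbrev Lp : Type := LaurentPolynomial ℤ

/-- The parameter `δ`. -/
noncomputable def δpar : Lp := LaurentPolynomial.T 1

/-- Generators of the Brauer algebra of type `B_n`: `r i` and `e i` for `0 ≤ i ≤ n-1`. -/
inductive BGen (n : ℕ) : Type
  | r (i : Fin n) : BGen n
  | e (i : Fin n) : BGen n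

/-- The generator `r i` viewed in the free algebra. -/
noncomputable def fr {n : ℕ} (i : Fin n) : FreeAlgebra Lp (BGen n) :=
  FreeAlgebra.ι Lp (BGen.r i)

/-- The generator `e i` viewed in the free algebra. -/
noncomputable def fe {n : ℕ} (i : Fin n) : FreeAlgebra Lp (BGen n) :=
  FreeAlgebra.ι Lp (BGen.e i)

/-- The defining relations of the Brauer algebra of type `B_n`. -/
inductive BrauerBRel (n : ℕ) : FreeAlgebra Lp (BGen n) → FreeAlgebra Lp (BGen n) → Prop
  | rr (i : Fin n) : BrauerBRel n (fr i * fr i) 1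
  | re (i : Fin n) : BrauerBRel n (fr i * fe i) (fe i)
  | er (i : Fin n) : BrauerBRel n (fe i * fr i) (fe i)
  | ee (i : Fin n) (h : 0 < i.val) : BrauerBRel n (fe i * fe i) (δpar • fe i)
  | e0e0 (i : Fin n) (h : i.val = 0) : BrauerBRel n (fe i * fe i) ((δpar * δpar) • fe i)
  | rrFar (i j : Fin n) (h : i.val + 2 ≤ j.val ∨ j.val + 2 ≤ i.val) :
      BrauerBRel n (fr i * fr j) (fr j * fr i)
  | erFar (i j : Fin n) (h : i.val + 2 ≤ j.val ∨ j.val + 2 ≤ i.val) :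
      BrauerBRel n (fe i * fr j) (fr j * fe i)
  | eeFar (i j : Fin n) (h : i.val + 2 ≤ j.val ∨ j.val + 2 ≤ i.val) :
      BrauerBRel n (fe i * fe j) (fe j * fe i)
  | braid (i j : Fin n) (h : i.val + 1 = j.val ∨ j.val + 1 = i.val)
      (hi : 0 < i.val) (hj : 0 < j.val) :
      BrauerBRel n (fr i * fr j * fr i) (fr j * fr i * fr j)
  | rre (i j : Fin n) (h : i.val + 1 = j.val ∨ j.val + 1 = i.val)
      (hi : 0 < i.val) (hj : 0 < j.val) :
      BrauerBRel n (fr j * fr i * fe j) (fe i * fe j)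
  | rer (i j : Fin n) (h : i.val + 1 = j.val ∨ j.val + 1 = i.val)
      (hi : 0 < i.val) (hj : 0 < j.val) :
      BrauerBRel n (fr i * fe j * fr i) (fr j * fe i * fr j)
  | b1010 (i j : Fin n) (h0 : i.val = 0) (h1 : j.val = 1) :
      BrauerBRel n (fr j * fr i * fr j * fr i) (fr i * fr j * fr i * fr j)
  | b_r0r1e0 (i j : Fin n) (h0 : i.val = 0) (h1 : j.val = 1) :
      BrauerBRel n (fr i * fr j * fe i) (fr j * fe i)
  | b_r0e1r0e1 (i j : Fin n) (h0 : i.val = 0) (h1 : j.val = 1) :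
      BrauerBRel n (fr i * fe j * fr i * fe j) (fe j * fe i * fe j)
  | b_r0r1r0e1 (i j : Fin n) (h0 : i.val = 0) (h1 : j.val = 1) :
      BrauerBRel n (fr i * fr j * fr i * fe j) (fe j * (fr i * fr j * fr i))
  | b_e0r1e0 (i j : Fin n) (h0 : i.val = 0) (h1 : j.val = 1) :
      BrauerBRel n (fe i * fr j * fe i) (δpar • fe i)
  | b_e0e1e0 (i j : Fin n) (h0 : i.val = 0) (h1 : j.val = 1) :
      BrauerBRel n (fe i * fe j * fe i) (δpar • fe i)
  | b_e0r1r0 (i j : Fin n) (h0 : i.val = 0) (h1 : j.val = 1) :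
      BrauerBRel n (fe i * fr j * fr i) (fe i * fr j)
  | b_e0e1r0 (i j : Fin n) (h0 : i.val = 0) (h1 : j.val = 1) :
      BrauerBRel n (fe i * fe j * fr i) (fe i * fe j)

/-- The Brauer algebra of type `B_n` over `ℤ[δ, δ⁻¹]`. -/
abbrev BrauerB (n : ℕ) : Type := RingQuot (BrauerBRel n)

/-- The generator `r i` of `Br(B_n)` (defined to be `1` for out-of-range indices). -/
noncomputable def rb (n : ℕ) (i : ℕ) : BrauerB n :=
  if h : i < n then RingQuot.mkAlgHom Lp (BrauerBRel n) (fr ⟨i, h⟩) else 1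

/-- The generator `e i` of `Br(B_n)` (defined to be `1` for out-of-range indices). -/
noncomputable def eb (n : ℕ) (i : ℕ) : BrauerB n :=
  if h : i < n then RingQuot.mkAlgHom Lp (BrauerBRel n) (fe ⟨i, h⟩) else 1


/-- The parameter `δ` is invertible, so scalar multiplication by it is injective. -/
theorem δpar_smul_injective {M : Type*} [AddCommGroup M] [Module Lp M] :
    Function.Injective (fun x : M => δpar • x) := by
  have hδ : (LaurentPolynomial.T (-1) : Lp) * δpar = 1 := by
    rw [δpar, ← LaurentPolynomial.T_add]
    simp
  intro x y hxy
  have := congrArg (fun z : M => (LaurentPolynomial.T (-1) : Lp) • z) hxy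
  simpa only [smul_smul, hδ, one_smul] using this

/-- In any algebra in which `δ` is invertible, four of the rank two relations of type `B`
force `e₁` to commute with its conjugate by `r₀`. -/
theorem commute_conj_of_typeB_relations {A : Type*} [Ring A] [Algebra Lp A] {r₀ e₀ e₁ : A}
    (hr : r₀ * r₀ = 1) (he : e₁ * e₁ = δpar • e₁)
    (hre : r₀ * e₁ * r₀ * e₁ = e₁ * e₀ * e₁) (her : e₀ * e₁ * r₀ = e₀ * e₁) :
    e₁ * (r₀ * e₁ * r₀) = (r₀ * e₁ * r₀) * e₁ := by
  have left : r₀ * (e₁ * r₀ * e₁) = e₁ * e₀ * e₁ := by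
    rw [← hre]
    simp only [mul_assoc]
  have eq_left : e₁ * r₀ * e₁ = r₀ * (e₁ * e₀ * e₁) := by
    rw [← left, ← mul_assoc r₀ r₀, hr, one_mul]
  have right : e₁ * r₀ * e₁ * r₀ = e₁ * r₀ * e₁ := by
    rw [eq_left]
    calc r₀ * (e₁ * e₀ * e₁) * r₀ = r₀ * (e₁ * (e₀ * e₁ * r₀)) := by simp only [mul_assoc]
      _ = r₀ * (e₁ * e₀ * e₁) := by rw [her, mul_assoc e₁ e₀ e₁]
  have fixed : r₀ * (e₁ * r₀ * e₁) = e₁ * r₀ * e₁ := by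
    apply δpar_smul_injective
    calc δpar • (r₀ * (e₁ * r₀ * e₁)) = δpar • (e₁ * e₀ * e₁) := by rw [left]
      _ = e₁ * e₁ * e₀ * e₁ := by rw [he]; simp only [smul_mul_assoc]
      _ = e₁ * (r₀ * (e₁ * r₀ * e₁)) := by rw [left]; simp only [mul_assoc]
      _ = e₁ * r₀ * e₁ * r₀ * e₁ := by simp only [mul_assoc]
      _ = e₁ * r₀ * (e₁ * e₁) := by rw [right, mul_assoc]
      _ = δpar • (e₁ * r₀ * e₁) := by rw [he, mul_smul_comm]
  calc e₁ * (r₀ * e₁ * r₀) = e₁ * r₀ * e₁ * r₀ := by simp only [mul_assoc]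
    _ = r₀ * (e₁ * r₀ * e₁) := by rw [right, fixed]
    _ = r₀ * e₁ * r₀ * e₁ := by simp only [mul_assoc]

/-- For `n ≥ 2`, the elements `e₁` and `e₁* = r₀e₁r₀` of `Br(B_n)` commute. -/
theorem statement_19 (n : ℕ) (hn : 2 ≤ n) :
    eb n 1 * (rb n 0 * eb n 1 * rb n 0) = (rb n 0 * eb n 1 * rb n 0) * eb n 1 := by
  have h0 : 0 < n := by omega
  have h1 : 1 < n := by omega
  have rel {x y} (h : BrauerBRel n x y) := RingQuot.mkAlgHom_rel Lp h
  simp only [rb, eb, dif_pos h0, dif_pos h1]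
  apply commute_conj_of_typeB_relations
    (e₀ := RingQuot.mkAlgHom Lp (BrauerBRel n) (fe ⟨0, h0⟩))
  · simpa using rel (.rr ⟨0, h0⟩)
  · simpa using rel (.ee ⟨1, h1⟩ one_pos)
  · simpa using rel (.b_r0e1r0e1 ⟨0, h0⟩ ⟨1, h1⟩ rfl rfl)
  · simpa using rel (.b_e0e1r0 ⟨0, h0⟩ ⟨1, h1⟩ rfl rfl)
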